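/- Let z_I be a nonzero complex number such that Z_M + Z_T ≠ 0 and 3/(8πa²z_I) + (1/2)(1−iha)/(Z_M+Z_T) ≠ 0, and define the rotational impedance Z̃ by a²/Z̃ = 3/(8πa²z_I) + (1/2)(1−iha)/(Z_M+Z_T). Suppose β, θ ∈ ℂ satisfy the interfacial slip condition β μ h [h₀(ha) − (3/(ha)) h₁(ha)] = iω z_I [β h₁(ha) − a θ]. Then the resultant moment satisfies (8/3)πa³ · β μ h [h₀(ha) − (3/(ha)) h₁(ha)] = −iω Z̃ θ. -/

import Mathlib

open Complex

/-- The rotational impedance of a spherical inclusion (Appendix A of the paper):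
if `β` satisfies the interfacial slip condition, then the resultant moment
`(8/3)πa³ β μ h [h₀(ha) − (3/(ha)) h₁(ha)]` equals `−iω Z̃ θ`, where the
rotational impedance `Z̃` is defined by
`a²/Z̃ = 3/(8πa²z_I) + (1/2)(1−iha)/(Z_M+Z_T)`. -/
theorem rotational_impedance_of_sphere (a ρ lam mu ω : ℝ)
    (ha : 0 < a) (hρ : 0 < ρ) (hmu : 0 < mu) (hlam : 0 < lam + 2 * mu) (hω : 0 < ω)
    (cT h : ℝ) (hcT : cT = Real.sqrt (mu / ρ)) (hh : h = ω / cT)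
    (sh0 sh1 : ℂ → ℂ)
    (hsh0 : ∀ z : ℂ, sh0 z = Complex.exp (I * z) / (I * z))
    (hsh1 : ∀ z : ℂ, sh1 z = -Complex.exp (I * z) * (z + I) / z ^ 2)
    (ZM ZT : ℂ)
    (hZM : ZM = I * ω * (4 / 3) * Real.pi * a ^ 3 * ρ)
    (hZT : ZT = (I * ω)⁻¹ * (4 * Real.pi * a * mu) * (1 - I * h * a))
    (zI : ℂ) (hzI : zI ≠ 0) (hMT : ZM + ZT ≠ 0)
    (hden : 3 / (8 * Real.pi * a ^ 2 * zI) + (1 / 2) * (1 - I * h * a) / (ZM + ZT) ≠ 0)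
    (Zt : ℂ)
    (hZt : (a : ℂ) ^ 2 / Zt
      = 3 / (8 * Real.pi * a ^ 2 * zI) + (1 / 2) * (1 - I * h * a) / (ZM + ZT))
    (β θ : ℂ)
    (hslip : β * mu * h * (sh0 ((h * a : ℝ)) - (3 / ((h * a : ℝ))) * sh1 ((h * a : ℝ)))
      = I * ω * zI * (β * sh1 ((h * a : ℝ)) - a * θ)) :
    (8 / 3) * Real.pi * a ^ 3
        * (β * mu * h * (sh0 ((h * a : ℝ)) - (3 / ((h * a : ℝ))) * sh1 ((h * a : ℝ))))
      = -(I * ω) * Zt * θ := by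
  have hc : 0 < cT := by rw [hcT]; exact Real.sqrt_pos.mpr (div_pos hmu hρ)
  have hhp : 0 < h := by rw [hh]; exact div_pos hω hc
  have hrel : ω ^ 2 * ρ = mu * h ^ 2 := by
    have h1 : cT ^ 2 = mu / ρ := by rw [hcT]; exact Real.sq_sqrt (div_pos hmu hρ).le
    have h2 : ω = h * cT := by rw [hh]; field_simp
    rw [h2, mul_pow, h1]; field_simp
  have hrelC : (ω : ℂ) ^ 2 * ρ = mu * (h : ℂ) ^ 2 := by exact_mod_cast hrel
  have haC : (a : ℂ) ≠ 0 := by exact_mod_cast ha.ne'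
  have hmC : (mu : ℂ) ≠ 0 := by exact_mod_cast hmu.ne'
  have hwC : (ω : ℂ) ≠ 0 := by exact_mod_cast hω.ne'
  have hhC : (h : ℂ) ≠ 0 := by exact_mod_cast hhp.ne'
  have hpC : (Real.pi : ℂ) ≠ 0 := by exact_mod_cast Real.pi_ne_zero
  have hI : I ≠ 0 := I_ne_zero
  have hI2 : I ^ 2 = -1 := I_sq
  obtain ⟨D, hD⟩ : ∃ D : ℂ, D = 3 - 3 * I * h * a - (h * a) ^ 2 := ⟨_, rfl⟩
  have hS : ZM + ZT = 4 * Real.pi * a * mu * D / (3 * (I * ω)) := by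
    rw [hZM, hZT, hD]
    field_simp
    linear_combination (a ^ 2 * ω ^ 2 * ρ) * hI2 - a ^ 2 * hrelC
  have hD0 : D ≠ 0 := by
    intro h0
    apply hMT
    rw [hS, h0]; simp
  have hZt0 : Zt ≠ 0 := by
    intro h0
    apply hden
    rw [← hZt, h0]; simp
  obtain ⟨T, hT⟩ : ∃ T : ℂ, T = β * mu * h * (sh0 ((h * a : ℝ)) - (3 / ((h * a : ℝ))) * sh1 ((h * a : ℝ))) := ⟨_, rfl⟩
  have hb : β * sh1 ((h * a : ℝ)) = -T * a * (1 - I * h * a) / (mu * D) := by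
    rw [eq_div_iff (mul_ne_zero hmC hD0), hT, hsh0, hsh1, hD]
    push_cast
    generalize Complex.exp (I * (h * a)) = E
    have hIi : E / (I * (h * a)) = -I * E / (h * a) := by
      field_simp
      linear_combination E * hI2
    rw [hIi]
    field_simp
    ring_nf
    simp only [hI2]
    ring
  rw [← hT] at hslip ⊢
  rw [hb] at hslip
  rw [hS] at hZt
  have e1 : T * (mu * D + I * ω * zI * a * (1 - I * h * a)) = -(I * ω * zI * a * θ * mu * D) := by
    have hx : -T * a * (1 - I * h * a) / (mu * D) * (mu * D) = -T * a * (1 - I * h * a) :=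
      div_mul_cancel₀ _ (mul_ne_zero hmC hD0)
    linear_combination (mu * D) * hslip + I * ω * zI * hx
  have e2 : (a : ℂ) ^ 4 * (8 * Real.pi * zI * mu * D)
      = Zt * (3 * (mu * D + I * ω * zI * a * (1 - I * h * a))) := by
    have hr : 3 / (8 * Real.pi * a ^ 2 * zI)
        + (1 / 2) * (1 - I * h * a) / (4 * Real.pi * a * mu * D / (3 * (I * ω)))
        = (3 * (mu * D + I * ω * zI * a * (1 - I * h * a)))
          / (8 * Real.pi * a ^ 2 * zI * mu * D) := by
      generalize 1 - I * h * a = q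
      field_simp
      ring
    rw [hr, div_eq_div_iff hZt0 (by simp [haC, hzI, hmC, hD0])] at hZt
    linear_combination hZt
  have hk : 3 * (a : ℂ) * zI * mu * D ≠ 0 := by simp [haC, hzI, hmC, hD0]
  apply mul_left_cancel₀ hk
  linear_combination T * e2 + 3 * Zt * e1
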